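/- Suppose |ℱ| < n. Then for every i ∈ [n], at least one of the following holds: (1) i ∈ M for some M ∈ ℳ; (2) i ∉ N for some N ∈ 𝒩; (3) there exists a set S ⊆ [n] with i ∉ S such that both S ∈ ℱ and S ∪ {i} ∈ ℱ. -/

import Mathlib

open Finset

/-- A family `F` of subsets of `[n]` (as subsets of `Fin n`) contains an induced copy of
the finite poset `P`: there is an injection `f : P → F` with `a ≤ b ↔ f a ⊆ f b`. -/
def ContainsCopy (P : Type) [PartialOrder P] {n : ℕ}
    (F : Set (Finset (Fin n))) : Prop :=
  ∃ f : P → Finset (Fin n), Function.Injective f ∧ (∀ a, f a ∈ F) ∧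
    ∀ a b : P, a ≤ b ↔ f a ⊆ f b

/-- `F` is `P`-saturated: it contains no induced copy of `P`, but adding any new set
creates one. -/
def IsSaturated (P : Type) [PartialOrder P] {n : ℕ}
    (F : Finset (Finset (Fin n))) : Prop :=
  ¬ ContainsCopy P (↑F : Set (Finset (Fin n))) ∧
    ∀ S : Finset (Fin n), S ∉ F →
      ContainsCopy P (insert S (↑F : Set (Finset (Fin n))))

/-- The induced saturation number `sat*(n, P)`. -/
noncomputable def satStar (n : ℕ) (P : Type) [PartialOrder P] : ℕ :=
  sInf {m | ∃ F : Finset (Finset (Fin n)), IsSaturated P F ∧ F.card = m}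

/-- The antichain poset `𝒜_k` with `k` elements. -/
def AC (k : ℕ) : Type := Fin k

instance (k : ℕ) : PartialOrder (AC k) where
  le a b := a = b
  le_refl _ := rfl
  le_trans _ _ _ h₁ h₂ := Eq.trans h₁ h₂
  le_antisymm _ _ h _ := h

instance (k : ℕ) : Fintype (AC k) := inferInstanceAs (Fintype (Fin k))

/-- `ℳ₀`: members of `F` whose down-set in `F` contains an induced copy of `P₂`. -/
def Mzero (P₂ : Type) [PartialOrder P₂] {n : ℕ} (F : Finset (Finset (Fin n))) :
    Set (Finset (Fin n)) :=
  {A | A ∈ F ∧ ContainsCopy P₂ {X | X ∈ F ∧ X ⊆ A}}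

/-- `ℳ`: the minimal elements of `ℳ₀`. -/
def Mfam (P₂ : Type) [PartialOrder P₂] {n : ℕ} (F : Finset (Finset (Fin n))) :
    Set (Finset (Fin n)) :=
  {A ∈ Mzero P₂ F | ∀ B ∈ Mzero P₂ F, B ⊆ A → B = A}

/-- `𝒩₀`: members of `F` whose up-set in `F` contains an induced copy of `P₁`. -/
def Nzero (P₁ : Type) [PartialOrder P₁] {n : ℕ} (F : Finset (Finset (Fin n))) :
    Set (Finset (Fin n)) :=
  {A | A ∈ F ∧ ContainsCopy P₁ {X | X ∈ F ∧ A ⊆ X}}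

/-- `𝒩`: the maximal elements of `𝒩₀`. -/
def Nfam (P₁ : Type) [PartialOrder P₁] {n : ℕ} (F : Finset (Finset (Fin n))) :
    Set (Finset (Fin n)) :=
  {A ∈ Nzero P₁ F | ∀ B ∈ Nzero P₁ F, A ⊆ B → A = B}

theorem containsCopy_of_forall_le_iff {P : Type} [PartialOrder P] {n : ℕ}
    {F : Set (Finset (Fin n))} (f : P → Finset (Fin n)) (hmem : ∀ a, f a ∈ F)
    (h : ∀ a b, a ≤ b ↔ f a ⊆ f b) : ContainsCopy P F :=
  ⟨f, fun a b hab => le_antisymm ((h a b).2 hab.subset) ((h b a).2 hab.symm.subset), hmem, h⟩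

/-- A copy of `P₁ * 𝒜_k * P₂` consists of a copy of `P₂`, an antichain of size `k` above it,
and a copy of `P₁` above the antichain. -/
theorem containsCopy_linearSum_iff {P₁ P₂ : Type} [PartialOrder P₁] [PartialOrder P₂] {n k : ℕ}
    (hk : 0 < k) {F : Set (Finset (Fin n))} :
    ContainsCopy (P₂ ⊕ₗ (AC k ⊕ₗ P₁)) F ↔
      ∃ (u : P₂ → Finset (Fin n)) (a : Fin k → Finset (Fin n)) (v : P₁ → Finset (Fin n)),
        (∀ p, u p ∈ F) ∧ (∀ j, a j ∈ F) ∧ (∀ q, v q ∈ F) ∧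
        (∀ p p', p ≤ p' ↔ u p ⊆ u p') ∧ (∀ j l, a j ⊆ a l → j = l) ∧
        (∀ q q', q ≤ q' ↔ v q ⊆ v q') ∧ (∀ p j, u p ⊂ a j) ∧ (∀ j q, a j ⊂ v q) := by
  constructor
  · rintro ⟨f, -, hmem, h⟩
    refine ⟨fun p => f (toLex (.inl p)), fun j => f (toLex (.inr (toLex (.inl j)))),
      fun q => f (toLex (.inr (toLex (.inr q)))), fun _ => hmem _, fun _ => hmem _,
      fun _ => hmem _, ?_, ?_, ?_, ?_, ?_⟩
    · intro p p'
      rw [← h, Sum.Lex.inl_le_inl_iff]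
    · intro j l hjl
      exact Sum.Lex.inl_le_inl_iff.1 (Sum.Lex.inr_le_inr_iff.1 ((h _ _).2 hjl))
    · intro q q'
      rw [← h, Sum.Lex.inr_le_inr_iff, Sum.Lex.inr_le_inr_iff]
    · intro p j
      rw [ssubset_iff_subset_not_subset, ← h, ← h]
      exact ⟨Sum.Lex.inl_le_inr _ _, Sum.Lex.not_inr_le_inl⟩
    · intro j q
      rw [ssubset_iff_subset_not_subset, ← h, ← h, Sum.Lex.inr_le_inr_iff,
        Sum.Lex.inr_le_inr_iff]
      exact ⟨Sum.Lex.inl_le_inr _ _, Sum.Lex.not_inr_le_inl⟩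
  · rintro ⟨u, a, v, hu, ha, hv, hu', ha', hv', hua, hav⟩
    have huv : ∀ p q, u p ⊂ v q := fun p q => (hua p ⟨0, hk⟩).trans (hav _ q)
    refine containsCopy_of_forall_le_iff
      (fun x => Sum.elim u (fun y => Sum.elim a v (ofLex y)) (ofLex x)) ?_ ?_
    · rintro (p | j | q)
      exacts [hu p, ha j, hv q]
    · rintro (p | j | q) (p' | j' | q')
      · exact Sum.Lex.inl_le_inl_iff.trans (hu' p p')
      · exact iff_of_true (Sum.Lex.inl_le_inr _ _) (hua p j').subset
      · exact iff_of_true (Sum.Lex.inl_le_inr _ _) (huv p q').subset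
      · exact iff_of_false Sum.Lex.not_inr_le_inl (hua p' j).not_subset
      · refine Sum.Lex.inr_le_inr_iff.trans (Sum.Lex.inl_le_inl_iff.trans ⟨?_, ha' j j'⟩)
        intro hjj
        exact (congrArg a (show j = j' from hjj)).subset
      · exact iff_of_true (Sum.Lex.inr_le_inr_iff.2 (Sum.Lex.inl_le_inr _ _)) (hav j q').subset
      · exact iff_of_false Sum.Lex.not_inr_le_inl (huv p' q).not_subset
      · exact iff_of_false (fun hle => Sum.Lex.not_inr_le_inl (Sum.Lex.inr_le_inr_iff.1 hle))
          (hav j' q).not_subset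
      · exact Sum.Lex.inr_le_inr_iff.trans (Sum.Lex.inr_le_inr_iff.trans (hv' q q'))

theorem mem_Mzero_of_forall_subset {P₂ : Type} [PartialOrder P₂] {n : ℕ}
    {F : Finset (Finset (Fin n))} {A : Finset (Fin n)} (hA : A ∈ F) (u : P₂ → Finset (Fin n))
    (hu : ∀ p, u p ∈ F) (hle : ∀ p p', p ≤ p' ↔ u p ⊆ u p') (huA : ∀ p, u p ⊆ A) :
    A ∈ Mzero P₂ F :=
  ⟨hA, containsCopy_of_forall_le_iff u (fun p => ⟨hu p, huA p⟩) hle⟩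

theorem mem_Nzero_of_forall_subset {P₁ : Type} [PartialOrder P₁] {n : ℕ}
    {F : Finset (Finset (Fin n))} {A : Finset (Fin n)} (hA : A ∈ F) (v : P₁ → Finset (Fin n))
    (hv : ∀ q, v q ∈ F) (hle : ∀ q q', q ≤ q' ↔ v q ⊆ v q') (hvA : ∀ q, A ⊆ v q) :
    A ∈ Nzero P₁ F :=
  ⟨hA, containsCopy_of_forall_le_iff v (fun q => ⟨hv q, hvA q⟩) hle⟩

theorem exists_mem_Mfam_subset {P₂ : Type} [PartialOrder P₂] {n : ℕ}
    {F : Finset (Finset (Fin n))} {A : Finset (Fin n)} (hA : A ∈ Mzero P₂ F) :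
    ∃ M ∈ Mfam P₂ F, M ⊆ A := by
  obtain ⟨M, hMA, hM⟩ := (Set.toFinite (Mzero P₂ F)).exists_le_minimal hA
  exact ⟨M, ⟨hM.prop, fun B hB hBM => hBM.antisymm (hM.le_of_le hB hBM)⟩, hMA⟩

theorem exists_mem_Nfam_superset {P₁ : Type} [PartialOrder P₁] {n : ℕ}
    {F : Finset (Finset (Fin n))} {A : Finset (Fin n)} (hA : A ∈ Nzero P₁ F) :
    ∃ N ∈ Nfam P₁ F, A ⊆ N := by
  obtain ⟨N, hAN, hN⟩ := (Set.toFinite (Nzero P₁ F)).exists_le_maximal hA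
  exact ⟨N, ⟨hN.prop, fun B hB hNB => hNB.antisymm (hN.le_of_ge hB hNB)⟩, hAN⟩

/-- Adding a missing set `T` to a saturated family creates a copy in which `T` belongs either to
the copy of `P₂`, or to the antichain, or to the copy of `P₁`. -/
theorem IsSaturated.exists_copy {P₁ P₂ : Type} [PartialOrder P₁] [PartialOrder P₂] {n k : ℕ}
    (hk : 0 < k) {F : Finset (Finset (Fin n))} (hF : IsSaturated (P₂ ⊕ₗ (AC k ⊕ₗ P₁)) F)
    {T : Finset (Fin n)} (hT : T ∉ F) :
    ∃ (u : P₂ → Finset (Fin n)) (a : Fin k → Finset (Fin n)) (v : P₁ → Finset (Fin n)),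
      (∀ p p', p ≤ p' ↔ u p ⊆ u p') ∧ (∀ j l, a j ⊆ a l → j = l) ∧
      (∀ q q', q ≤ q' ↔ v q ⊆ v q') ∧ (∀ p j, u p ⊂ a j) ∧ (∀ j q, a j ⊂ v q) ∧
      (((∃ p, u p = T) ∧ (∀ j, a j ∈ F) ∧ (∀ q, v q ∈ F)) ∨
       ((∃ j, a j = T ∧ ∀ l, l ≠ j → a l ∈ F) ∧ (∀ p, u p ∈ F) ∧ (∀ q, v q ∈ F)) ∨
       ((∃ q, v q = T) ∧ (∀ p, u p ∈ F) ∧ (∀ j, a j ∈ F))) := by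
  obtain ⟨u, a, v, hu, ha, hv, hu', ha', hv', hua, hav⟩ :=
    (containsCopy_linearSum_iff hk).1 (hF.2 T hT)
  have huv : ∀ p q, u p ⊂ v q := fun p q => (hua p ⟨0, hk⟩).trans (hav _ q)
  refine ⟨u, a, v, hu', ha', hv', hua, hav, ?_⟩
  by_cases hp : ∃ p, u p = T
  · obtain ⟨p, rfl⟩ := hp
    exact Or.inl ⟨⟨p, rfl⟩, fun j => (ha j).resolve_left (hua p j).ne',
      fun q => (hv q).resolve_left (huv p q).ne'⟩
  have huF : ∀ p, u p ∈ F := fun p => (hu p).resolve_left fun h => hp ⟨p, h⟩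
  by_cases hj : ∃ j, a j = T
  · obtain ⟨j, rfl⟩ := hj
    exact Or.inr (Or.inl ⟨⟨j, rfl, fun l hl => (ha l).resolve_left
      fun h => hl (ha' l j h.subset)⟩, huF, fun q => (hv q).resolve_left (hav j q).ne'⟩)
  have haF : ∀ j, a j ∈ F := fun j => (ha j).resolve_left fun h => hj ⟨j, h⟩
  by_cases hq : ∃ q, v q = T
  · exact Or.inr (Or.inr ⟨hq, huF, haF⟩)
  · exact absurd ((containsCopy_linearSum_iff hk).2 ⟨u, a, v, huF, haF,
      fun q => (hv q).resolve_left fun h => hq ⟨q, h⟩, hu', ha', hv', hua, hav⟩) hF.1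

theorem IsSaturated.Mzero_nonempty {P₁ P₂ : Type} [PartialOrder P₁] [PartialOrder P₂] {n k : ℕ}
    (hk : 2 ≤ k) {F : Finset (Finset (Fin n))} (hF : IsSaturated (P₂ ⊕ₗ (AC k ⊕ₗ P₁)) F)
    (hcard : F.card < n) : (Mzero P₂ F).Nonempty := by
  have : Nontrivial (Fin k) := Fin.nontrivial_iff_two_le.2 hk
  obtain ⟨x, hx⟩ : ∃ x : Fin n, ({x}ᶜ : Finset (Fin n)) ∉ F := by
    by_contra! hall
    have := Finset.card_le_card_of_injOn (s := Finset.univ) (t := F)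
      (fun x : Fin n => ({x}ᶜ : Finset (Fin n))) (fun x _ => hall x)
      (fun x _ y _ h => Finset.singleton_injective (compl_injective h))
    rw [Finset.card_univ, Fintype.card_fin] at this
    omega
  obtain ⟨u, a, v, hu', ha', -, hua, -, ⟨⟨p, hp⟩, -, -⟩ | ⟨⟨j, -, haF⟩, huF, -⟩ | ⟨-, huF, haF⟩⟩ :=
    hF.exists_copy (by omega) hx
  · have huniv : ∀ j, a j = Finset.univ := fun j =>
      (Finset.isCoatom_compl_singleton x).2 _ (hp ▸ hua p j)
    obtain ⟨j, l, hjl⟩ := exists_pair_ne (Fin k)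
    exact absurd (ha' j l ((huniv j).trans (huniv l).symm).subset) hjl
  · obtain ⟨l, hl⟩ := exists_ne j
    exact ⟨a l, mem_Mzero_of_forall_subset (haF l hl) u huF hu' fun p => (hua p l).subset⟩
  · exact ⟨a ⟨0, by omega⟩,
      mem_Mzero_of_forall_subset (haF _) u huF hu' fun p => (hua p _).subset⟩

/-- If `i` lies in no member of `ℳ`, a member `X ∌ i` of `ℳ₀` which is either minimal or
contained in a member of `𝒩₀` containing `i` is strictly contained in a member of `ℳ₀ ∩ 𝒩₀`
avoiding `i`, provided that `X ∪ {i} ∉ F`. -/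
theorem IsSaturated.exists_ssuperset {P₁ P₂ : Type} [PartialOrder P₁] [PartialOrder P₂]
    {n k : ℕ} (hk : 2 ≤ k) (hP₂ : ∃ t : P₂, ∀ p, p ≤ t) {F : Finset (Finset (Fin n))}
    (hF : IsSaturated (P₂ ⊕ₗ (AC k ⊕ₗ P₁)) F) {i : Fin n} (hi : ∀ M ∈ Mfam P₂ F, i ∉ M)
    {X : Finset (Fin n)} (hX : X ∈ Mzero P₂ F) (hiX : i ∉ X) (hXi : insert i X ∉ F)
    (hXN : X ∈ Mfam P₂ F ∨ ∃ N ∈ Nzero P₁ F, i ∈ N ∧ X ⊆ N) :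
    ∃ A ∈ Mzero P₂ F, A ∈ Nzero P₁ F ∧ i ∉ A ∧ X ⊂ A := by
  have : Nontrivial (Fin k) := Fin.nontrivial_iff_two_le.2 hk
  have hk0 : 0 < k := by omega
  have hXss : X ⊂ insert i X := Finset.ssubset_insert hiX
  obtain ⟨t, ht⟩ := hP₂
  obtain ⟨u, a, v, hu', ha', hv', hua, hav, h⟩ := hF.exists_copy hk0 hXi
  -- a member of `ℳ` below a copy of `P₂` inside `X ∪ {i}` lies inside `X`
  have key : (∀ p, u p ∈ F) → u t ⊆ insert i X → ∃ M ∈ Mfam P₂ F, M ⊆ u t ∧ M ⊆ X := by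
    intro huF hut
    obtain ⟨M, hM, hMu⟩ := exists_mem_Mfam_subset
      (mem_Mzero_of_forall_subset (huF t) u huF hu' fun p => (hu' p t).1 (ht p))
    exact ⟨M, hM, hMu, (Finset.subset_insert_iff_of_notMem (hi M hM)).1 (hMu.trans hut)⟩
  rcases h with ⟨⟨p, hp⟩, haF, hvF⟩ | ⟨⟨j, hj, haF⟩, huF, hvF⟩ | ⟨⟨q, hq⟩, huF, haF⟩
  · obtain ⟨-, w, -, hwF, hw⟩ := hX
    refine absurd ((containsCopy_linearSum_iff hk0).2 ⟨w, a, v, fun p => (hwF p).1, haF, hvF,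
      hw, ha', hv', fun p' j => ?_, hav⟩) hF.1
    exact ((hwF p').2.trans_ssubset hXss).trans (hp ▸ hua p j)
  · obtain ⟨M, hM, hMu, hMX⟩ := key huF (hj ▸ (hua t j).subset)
    obtain ⟨l, hlj, hXl⟩ : ∃ l, l ≠ j ∧ X ⊆ a l := by
      by_contra! hcon
      obtain ⟨l, hl⟩ := exists_ne j
      have hMXss : M ⊂ X := hMX.ssubset_of_ne fun h =>
        hcon l hl (h ▸ hMu.trans (hua t l).subset)
      obtain ⟨-, w, -, hwF, hw⟩ := hM.1
      refine hF.1 ((containsCopy_linearSum_iff hk0).2 ⟨w, Function.update a j X, v,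
        fun p => (hwF p).1, fun m => ?_, hvF, hw, fun m m' hmm => ?_, hv', fun p m => ?_,
        fun m q => ?_⟩)
      · by_cases hm : m = j
        · subst hm
          simpa using hX.1
        · simpa [hm] using haF m hm
      · by_cases hm : m = j <;> by_cases hm' : m' = j
        · rw [hm, hm']
        · subst hm
          rw [Function.update_self, Function.update_of_ne hm'] at hmm
          exact absurd hmm (hcon m' hm')
        · subst hm'
          rw [Function.update_self, Function.update_of_ne hm] at hmm
          exact ha' m m' (hj ▸ hmm.trans hXss.subset)
        · rw [Function.update_of_ne hm, Function.update_of_ne hm'] at hmm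
          exact ha' m m' hmm
      · by_cases hm : m = j
        · subst hm
          rw [Function.update_self]
          exact (hwF p).2.trans_ssubset hMXss
        · rw [Function.update_of_ne hm]
          exact ((hwF p).2.trans hMu).trans_ssubset (hua t m)
      · by_cases hm : m = j
        · subst hm
          rw [Function.update_self]
          exact hXss.trans (hj ▸ hav m q)
        · rw [Function.update_of_ne hm]
          exact hav m q
    refine ⟨a l, mem_Mzero_of_forall_subset (haF l hlj) u huF hu' fun p => (hua p l).subset,
      mem_Nzero_of_forall_subset (haF l hlj) v hvF hv' fun q => (hav l q).subset,
      fun hil => ?_, hXl.ssubset_of_ne fun h => ?_⟩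
    · exact hlj (ha' j l (hj ▸ Finset.insert_subset hil hXl)).symm
    · exact hlj (ha' l j (by rw [hj, ← h]; exact hXss.subset))
  · rcases hXN with hXM | ⟨N, ⟨hNF, w, -, hwF, hw⟩, hiN, hXN⟩
    · have hlt : a ⟨0, hk0⟩ ⊂ insert i X := hq ▸ hav _ q
      obtain ⟨M, hM, hMu, hMX⟩ := key huF ((hua t _).trans hlt).subset
      have hXa : X ⊂ a ⟨0, hk0⟩ := hXM.2 M hM.1 hMX ▸ hMu.trans_ssubset (hua t _)
      exact absurd hlt ((Finset.covBy_insert hiX).2 hXa)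
    · have hN : insert i X ⊆ N := Finset.insert_subset hiN hXN
      exact absurd ((containsCopy_linearSum_iff hk0).2 ⟨u, a, w, huF, haF, fun q => (hwF q).1,
        hu', ha', hw, hua, fun j q' => (hq ▸ hav j q).trans_subset (hN.trans (hwF q').2)⟩) hF.1

/-- Lemma: second preliminary lemma. -/
theorem statement3 {n : ℕ} (P₁ P₂ : Type) [PartialOrder P₁] [PartialOrder P₂]
    [Fintype P₁] [Fintype P₂]
    (k : ℕ) (hk : 2 ≤ k)
    (hP₁ : ∃! a : P₁, IsMin a) (hP₂ : ∃! a : P₂, IsMax a)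
    (F : Finset (Finset (Fin n)))
    (hF : IsSaturated (P₂ ⊕ₗ (AC k ⊕ₗ P₁)) F)
    (hcard : F.card < n) (i : Fin n) :
    (∃ M ∈ Mfam P₂ F, i ∈ M) ∨
    (∃ N ∈ Nfam P₁ F, i ∉ N) ∨
    (∃ S : Finset (Fin n), i ∉ S ∧ S ∈ F ∧ insert i S ∈ F) := by
  by_contra! hcon
  obtain ⟨hM, hN, hS⟩ := hcon
  have htop : ∃ t : P₂, ∀ p, p ≤ t := by
    obtain ⟨t, -, huniq⟩ := hP₂
    refine ⟨t, fun p => ?_⟩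
    obtain ⟨m, hpm, hm⟩ := (Set.toFinite (Set.univ : Set P₂)).exists_le_maximal (Set.mem_univ p)
    exact huniq m (maximal_true.1 (by simpa using hm)) ▸ hpm
  obtain ⟨A₀, hA₀⟩ := hF.Mzero_nonempty hk hcard
  obtain ⟨M, hMfam, -⟩ := exists_mem_Mfam_subset hA₀
  obtain ⟨A, hAM, hAN, hiA, -⟩ := hF.exists_ssuperset hk htop hM hMfam.1 (hM M hMfam)
    (hS M (hM M hMfam) hMfam.1.1) (Or.inl hMfam)
  obtain ⟨X, -, hXmax⟩ := (Set.toFinite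
    {A | A ∈ Mzero P₂ F ∧ A ∈ Nzero P₁ F ∧ i ∉ A}).exists_le_maximal ⟨hAM, hAN, hiA⟩
  obtain ⟨hXM, hXN, hiX⟩ := hXmax.prop
  obtain ⟨N, hNfam, hXsub⟩ := exists_mem_Nfam_superset hXN
  obtain ⟨B, hBM, hBN, hiB, hXB⟩ := hF.exists_ssuperset hk htop hM hXM hiX (hS X hiX hXM.1)
    (Or.inr ⟨N, hNfam.1, hN N hNfam, hXsub⟩)
  exact hXmax.not_prop_of_gt hXB ⟨hBM, hBN, hiB⟩
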